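/- A linear code C of length n over R is cyclic if and only if its Gray image φ(C) is a 4-quasi-cyclic code of length 4n over F_q; more precisely, φ ∘ σ = σ⁴ ∘ φ, where σ denotes the cyclic shift on Rⁿ and on F_q^{4n} respectively. -/

import Mathlib

set_option synthInstance.maxHeartbeats 1000000
set_option maxHeartbeats 1000000

noncomputable section

open MvPolynomial

/-- Generators u^2-u, v^2-v of the defining ideal. -/
def genSet (F : Type) [Field F] : Set (MvPolynomial (Fin 2) F) :=
  {X 0 ^ 2 - X 0, X 1 ^ 2 - X 1}

/-- The ring R = F_q[u,v]/(u^2-u, v^2-v). -/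
abbrev Rq (F : Type) [Field F] := MvPolynomial (Fin 2) F ⧸ Ideal.span (genSet F)

/-- The image of u in R. -/
def uu (F : Type) [Field F] : Rq F := Ideal.Quotient.mk _ (X 0)

/-- The image of v in R. -/
def vv (F : Type) [Field F] : Rq F := Ideal.Quotient.mk _ (X 1)

/-- Evaluation of R at a point (x,y) with x^2 = x, y^2 = y. -/
def phi4 (F : Type) [Field F] (p : Fin 2 → F) (hp : ∀ i, p i ^ 2 = p i) : Rq F →+* F :=
  Ideal.Quotient.lift _ (aeval p).toRingHom (by
    intro a ha
    have h : Ideal.span (genSet F) ≤ RingHom.ker (aeval p).toRingHom := by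
      rw [Ideal.span_le]
      rintro g (rfl | rfl) <;> simp [RingHom.mem_ker, hp 0, hp 1]
    exact h ha)

/-- The projections φ₁, φ₂, φ₃, φ₄ : R → F_q sending a+bu+cv+duv to
a, a+b+c+d, a+b, a+c respectively (i.e. evaluation at (0,0),(1,1),(1,0),(0,1)). -/
def phiI (F : Type) [Field F] : Fin 4 → (Rq F →+* F) :=
  ![phi4 F ![0,0] (by intro i; fin_cases i <;> norm_num),
    phi4 F ![1,1] (by intro i; fin_cases i <;> norm_num),
    phi4 F ![1,0] (by intro i; fin_cases i <;> norm_num),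
    phi4 F ![0,1] (by intro i; fin_cases i <;> norm_num)]

/-- Hamming weight: the number of nonzero coordinates. -/
def hNorm {ι α : Type} [Fintype ι] [Zero α] (x : ι → α) : ℕ := Nat.card {i // x i ≠ 0}

/-- The Gray map R → F_q⁴, a+bu+cv+duv ↦ (d, c+d, b+d, a+b+c+d), written in terms of
the projections φᵢ. -/
def gray1 (F : Type) [Field F] (r : Rq F) : Fin 4 → F :=
  ![phiI F 1 r - phiI F 2 r - phiI F 3 r + phiI F 0 r,
    phiI F 1 r - phiI F 2 r, phiI F 1 r - phiI F 3 r, phiI F 1 r]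

/-- The Gray map Rⁿ → F_q^{4n}, with flat indexing by Fin (4*n). -/
def grayFlat (F : Type) [Field F] (n : ℕ) (r : Fin n → Rq F) : Fin (4 * n) → F :=
  fun k => gray1 F (r ⟨k.val / 4, by have := k.isLt; omega⟩) ⟨k.val % 4, by omega⟩

/-- The cyclic shift (c₀,...,c_{m-1}) ↦ (c_{m-1}, c₀, ..., c_{m-2}). -/
def shift1 {α : Type} {m : ℕ} (c : Fin m → α) : Fin m → α := c ∘ (finRotate m).symm

theorem finRotate_symm_val {m : ℕ} (i : Fin m) :
    ((finRotate m).symm i).val = if i.val = 0 then m - 1 else i.val - 1 := by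
  obtain ⟨j, rfl⟩ := (finRotate m).surjective i
  rw [Equiv.symm_apply_apply]
  cases m with
  | zero => exact j.elim0
  | succ m =>
    have hj := j.isLt
    rcases Nat.lt_or_ge j.val m with h | h
    · rw [coe_finRotate_of_ne_last (by simp [Fin.ext_iff]; omega)]
      simp
    · have hl : j = Fin.last m := Fin.ext (by simp; omega)
      subst hl
      simp

theorem grayFlat_shift1 (F : Type) [Field F] (n : ℕ) (r : Fin n → Rq F) :
    grayFlat F n (shift1 r) = shift1^[4] (grayFlat F n r) := by
  funext k
  have hk := k.isLt
  simp only [Function.iterate_succ, Function.iterate_zero, Function.comp_apply, id_eq,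
    shift1, grayFlat]
  have hval : ((finRotate (4 * n)).symm ((finRotate (4 * n)).symm
      ((finRotate (4 * n)).symm ((finRotate (4 * n)).symm k)))).val =
      if k.val < 4 then k.val + 4 * n - 4 else k.val - 4 := by
    simp only [finRotate_symm_val]
    split_ifs <;> omega
  congr 2
  · apply Fin.ext
    simp only [finRotate_symm_val (m := n), hval]
    split_ifs <;> omega
  · rw [hval]
    split_ifs <;> omega

theorem uu_mul_uu (F : Type) [Field F] : uu F * uu F = uu F := by
  rw [uu, ← map_mul, Ideal.Quotient.eq, ← pow_two]
  exact Ideal.subset_span (Or.inl rfl)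

theorem vv_mul_vv (F : Type) [Field F] : vv F * vv F = vv F := by
  rw [vv, ← map_mul, Ideal.Quotient.eq, ← pow_two]
  exact Ideal.subset_span (Or.inr rfl)

theorem exists_eq_add_uu_add_vv (F : Type) [Field F] (r : Rq F) :
    ∃ a b c d : F, r = algebraMap F (Rq F) a + algebraMap F (Rq F) b * uu F +
      algebraMap F (Rq F) c * vv F + algebraMap F (Rq F) d * (uu F * vv F) := by
  obtain ⟨p, rfl⟩ := Ideal.Quotient.mk_surjective r
  induction p using MvPolynomial.induction_on with
  | C a => exact ⟨a, 0, 0, 0, by simp only [map_zero, zero_mul, add_zero]; rfl⟩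
  | add p q hp hq =>
    obtain ⟨a, b, c, d, h⟩ := hp
    obtain ⟨a', b', c', d', h'⟩ := hq
    refine ⟨a + a', b + b', c + c', d + d', ?_⟩
    rw [map_add, h, h']
    simp only [map_add]
    ring
  | mul_X p i hp =>
    obtain ⟨a, b, c, d, h⟩ := hp
    have hu := uu_mul_uu F
    have hv := vv_mul_vv F
    rw [map_mul, h]
    fin_cases i
    · refine ⟨0, a + b, 0, c + d, ?_⟩
      change _ * uu F = _
      simp only [map_add, map_zero]
      linear_combination (algebraMap F (Rq F) b + algebraMap F (Rq F) d * vv F) * hu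
    · refine ⟨0, 0, a + c, b + d, ?_⟩
      change _ * vv F = _
      simp only [map_add, map_zero]
      linear_combination (algebraMap F (Rq F) c + algebraMap F (Rq F) d * uu F) * hv

theorem phi4_algebraMap (F : Type) [Field F] (p : Fin 2 → F) (hp : ∀ i, p i ^ 2 = p i) (a : F) :
    phi4 F p hp (algebraMap F (Rq F) a) = a := by
  change phi4 F p hp (Ideal.Quotient.mk _ (MvPolynomial.C a)) = a
  simp [phi4]

theorem phi4_uu (F : Type) [Field F] (p : Fin 2 → F) (hp : ∀ i, p i ^ 2 = p i) :
    phi4 F p hp (uu F) = p 0 := by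
  simp [phi4, uu]

theorem phi4_vv (F : Type) [Field F] (p : Fin 2 → F) (hp : ∀ i, p i ^ 2 = p i) :
    phi4 F p hp (vv F) = p 1 := by
  simp [phi4, vv]

/-- The Gray map in terms of the coefficients of `1, u, v, uv`. -/
theorem gray1_eq (F : Type) [Field F] (a b c d : F) :
    gray1 F (algebraMap F (Rq F) a + algebraMap F (Rq F) b * uu F +
      algebraMap F (Rq F) c * vv F + algebraMap F (Rq F) d * (uu F * vv F)) =
      ![d, c + d, b + d, a + b + c + d] := by
  funext i
  fin_cases i <;>
    simp [gray1, phiI, phi4_algebraMap, phi4_uu, phi4_vv] <;> ring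

theorem gray1_injective (F : Type) [Field F] : Function.Injective (gray1 F) := by
  intro r s h
  obtain ⟨a, b, c, d, rfl⟩ := exists_eq_add_uu_add_vv F r
  obtain ⟨a', b', c', d', rfl⟩ := exists_eq_add_uu_add_vv F s
  rw [gray1_eq, gray1_eq] at h
  have hd : d = d' := congrFun h 0
  have hc : c + d = c' + d' := congrFun h 1
  have hb : b + d = b' + d' := congrFun h 2
  have ha : a + b + c + d = a' + b' + c' + d' := congrFun h 3
  obtain rfl := hd
  obtain rfl := add_right_cancel hc
  obtain rfl := add_right_cancel hb
  obtain rfl : a = a' := by linear_combination ha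
  rfl

theorem grayFlat_injective (F : Type) [Field F] (n : ℕ) :
    Function.Injective (grayFlat F n) := by
  intro r s h
  funext i
  apply gray1_injective F
  funext j
  have hi := i.isLt
  have hj := j.isLt
  have hij := congrFun h ⟨4 * i.val + j.val, by omega⟩
  have hdiv : (4 * i.val + j.val) / 4 = i.val := by omega
  have hmod : (4 * i.val + j.val) % 4 = j.val := by omega
  simpa only [grayFlat, hdiv, hmod, Fin.eta] using hij

theorem stmt15 (F : Type) [Field F] [Fintype F] (n : ℕ)
    (C : Submodule (Rq F) (Fin n → Rq F)) :
    (∀ r : Fin n → Rq F, grayFlat F n (shift1 r) = shift1^[4] (grayFlat F n r)) ∧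
    ((∀ c ∈ C, shift1 c ∈ C) ↔
      (∀ y ∈ grayFlat F n '' (C : Set (Fin n → Rq F)),
        shift1^[4] y ∈ grayFlat F n '' (C : Set (Fin n → Rq F)))) := by
  refine ⟨grayFlat_shift1 F n, ?_⟩
  rw [Set.forall_mem_image]
  refine forall₂_congr fun c _ => ?_
  rw [← grayFlat_shift1, (grayFlat_injective F n).mem_set_image, SetLike.mem_coe]
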